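/- Let Ω ⊆ ℝ^D be open, H = a·∇ a C^∞ vector field on Ω with a(x) ≠ 0 for all x ∈ Ω, and Σ a C^∞ hypersurface of Ω that is closed as a subset of Ω. Let μ and ν be N×N matrix-valued Radon measures on Ω, let b, c : Ω → ℂ^{N×N} be C^∞, suppose Hμ + bμ + μc = ν holds in the sense of distributions, that ν is absolutely continuous with respect to μ, and that supp ν ⊆ Σ. Then for every ordinal α, supp ν ⊆ F(α;H;Σ). -/

import Mathlib

noncomputable section
open Topology MeasureTheory


/-- The directional derivative `(Hf)(x) = a(x)·∇f(x)` of `f` along the vector field `a`. -/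
def vfDeriv {D : ℕ} (a : (Fin D → ℝ) → (Fin D → ℝ)) (f : (Fin D → ℝ) → ℝ) :
    (Fin D → ℝ) → ℝ :=
  fun x => fderiv ℝ f x (a x)

/-- The iterate `H^k f` of the vector field `H = a·∇` applied to `f`. -/
def vfIter {D : ℕ} (a : (Fin D → ℝ) → (Fin D → ℝ)) :
    ℕ → ((Fin D → ℝ) → ℝ) → ((Fin D → ℝ) → ℝ)
  | 0, f => f
  | k + 1, f => vfDeriv a (vfIter a k f)

/-- `γ` is a local defining function, on the open set `U ⊆ Ω`, for the hypersurface `S` of `Ω`. -/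
def IsLocalDefining {D : ℕ} (Ω S U : Set (Fin D → ℝ)) (γ : (Fin D → ℝ) → ℝ) : Prop :=
  IsOpen U ∧ U ⊆ Ω ∧ ContDiffOn ℝ (⊤ : ℕ∞) γ U ∧ (∀ y ∈ U, fderiv ℝ γ y ≠ 0) ∧
    S ∩ U = {y ∈ U | γ y = 0}

/-- `S` is a `C^∞` hypersurface of the open set `Ω`. -/
def IsHypersurface {D : ℕ} (Ω S : Set (Fin D → ℝ)) : Prop :=
  S ⊆ Ω ∧ ∀ x ∈ S, ∃ U γ, IsLocalDefining Ω S U γ ∧ x ∈ U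

/-- The set `Σ(k;H)` of points of `S` where the vector field `H = a·∇` has contact of
exact order `k` with `S` (for `k = 0`, `H` is transverse to `S`). -/
def contactSet {D : ℕ} (a : (Fin D → ℝ) → (Fin D → ℝ)) (Ω S : Set (Fin D → ℝ)) (k : ℕ) :
    Set (Fin D → ℝ) :=
  {x | x ∈ S ∧ ∃ U γ, IsLocalDefining Ω S U γ ∧ x ∈ U ∧
    (∀ i, 1 ≤ i → i ≤ k → vfIter a i γ x = 0) ∧ vfIter a (k + 1) γ x ≠ 0}

/-- The set `Σ(∞;H)` of points of `S` where `H = a·∇` is tangent to `S` at infinite order. -/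
def contactInf {D : ℕ} (a : (Fin D → ℝ) → (Fin D → ℝ)) (Ω S : Set (Fin D → ℝ)) :
    Set (Fin D → ℝ) :=
  {x | x ∈ S ∧ ∃ U γ, IsLocalDefining Ω S U γ ∧ x ∈ U ∧
    ∀ i, 1 ≤ i → vfIter a i γ x = 0}

/-- The transfinite family `F(α;H;Σ)` of Definition 3.3. -/
def Fset {D : ℕ} (a : (Fin D → ℝ) → (Fin D → ℝ)) (Ω S : Set (Fin D → ℝ)) (α : Ordinal) :
    Set (Fin D → ℝ) :=
  Ordinal.limitRecOn α (contactInf a Ω S)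
    (fun _β Fβ => Fβ \ {x | ∃ U Θ, IsOpen U ∧ x ∈ U ∧ U ⊆ Ω ∧ IsHypersurface U Θ ∧
        Fβ ∩ U ⊆ Θ ∧ ∃ k : ℕ, x ∈ contactSet a U Θ k})
    (fun _α _ IH => ⋂ (β) (h : _), IH β h)

/-- An `N×N` matrix of (locally finite, complex) Radon measures on the open set `Ω ⊆ ℝ^D`.
Each entry `μ_{pq}` is encoded by its polar decomposition: a positive Borel measure
`ρ p q` (the total variation `|μ_{pq}|`), locally finite on `Ω` and carried by `Ω`,
together with a measurable density `dens p q` of modulus one, so that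
`μ_{pq}(B) = ∫_B dens p q ∂(ρ p q)`. -/
structure MatRadonMeasure (D N : ℕ) (Ω : Set (Fin D → ℝ)) where
  ρ : Fin N → Fin N → Measure (Fin D → ℝ)
  dens : Fin N → Fin N → (Fin D → ℝ) → ℂ
  locFin : ∀ p q, ∀ x ∈ Ω, ∃ U, IsOpen U ∧ x ∈ U ∧ ρ p q U < ⊤
  carried : ∀ p q, ρ p q Ωᶜ = 0
  meas_dens : ∀ p q, Measurable (dens p q)
  norm_dens : ∀ p q x, ‖dens p q x‖ = 1

namespace MatRadonMeasure

variable {D N : ℕ} {Ω : Set (Fin D → ℝ)}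

/-- The value `μ_{pq}(B)` of the entry measure on a Borel set `B`. -/
def entry (μ : MatRadonMeasure D N Ω) (p q : Fin N) (B : Set (Fin D → ℝ)) : ℂ :=
  ∫ x in B, μ.dens p q x ∂(μ.ρ p q)

/-- `tr ∫ ψ dμ = Σ_{p,q} ∫ ψ_{qp} dμ_{pq}`. -/
def trInt (μ : MatRadonMeasure D N Ω) (ψ : (Fin D → ℝ) → Fin N → Fin N → ℂ) : ℂ :=
  ∑ p, ∑ q, ∫ x, ψ x q p * μ.dens p q x ∂(μ.ρ p q)

/-- `1_S μ = 0` : every Borel subset of `S` is null for every entry of `μ`. -/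
def VanishesOn (μ : MatRadonMeasure D N Ω) (S : Set (Fin D → ℝ)) : Prop :=
  ∀ p q, ∀ B ⊆ S, MeasurableSet B → μ.entry p q B = 0

/-- The support of `μ` : the complement in `Ω` of the largest open set
on which all entries of `μ` vanish. -/
def support (μ : MatRadonMeasure D N Ω) : Set (Fin D → ℝ) :=
  {x | x ∈ Ω ∧ ∀ V, IsOpen V → x ∈ V → ¬ μ.VanishesOn V}

/-- `ν` is absolutely continuous with respect to `μ` : any Borel set null for `|μ_{pq}|`
for all `p, q` is also null for `|ν_{pq}|` for all `p, q`. -/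
def AC (ν μ : MatRadonMeasure D N Ω) : Prop :=
  ∀ B, MeasurableSet B → (∀ p q, μ.ρ p q B = 0) → ∀ p q, ν.ρ p q B = 0

end MatRadonMeasure

/-- The divergence `div a = Σ_l ∂a_l/∂x_l` of the vector field `a`. -/
def divergence {D : ℕ} (a : (Fin D → ℝ) → (Fin D → ℝ)) (x : Fin D → ℝ) : ℝ :=
  ∑ l, fderiv ℝ (fun y => a y l) x (Pi.single l 1)

/-- The equation `Hμ + bμ + μc = ν` in the sense of distributions on `Ω`, where `H = a·∇`:
for every smooth compactly supported matrix-valued `φ` with support in `Ω`,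
`−tr∫ (a·∇φ + (div a)φ) dμ + tr∫ φb dμ + tr∫ cφ dμ = tr∫ φ dν`. -/
def DistribEq {D N : ℕ} {Ω : Set (Fin D → ℝ)} (a : (Fin D → ℝ) → (Fin D → ℝ))
    (b c : (Fin D → ℝ) → Fin N → Fin N → ℂ) (μ ν : MatRadonMeasure D N Ω) : Prop :=
  ∀ φ : (Fin D → ℝ) → Fin N → Fin N → ℂ,
    ContDiff ℝ (⊤ : ℕ∞) φ → HasCompactSupport φ → tsupport φ ⊆ Ω →
    - μ.trInt (fun x q p => fderiv ℝ (fun y => φ y q p) x (a x)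
          + (divergence a x : ℂ) * φ x q p)
      + μ.trInt (fun x q p => ∑ r, φ x q r * b x r p)
      + μ.trInt (fun x q p => ∑ r, c x q r * φ x r p)
      = ν.trInt φ

section Aux
open Set Filter

lemma aux_compact_lt_top {D N : ℕ} {Ω : Set (Fin D → ℝ)} (μ : MatRadonMeasure D N Ω)
    (p q : Fin N) {K : Set (Fin D → ℝ)} (hK : IsCompact K) (hKΩ : K ⊆ Ω) : μ.ρ p q K < ⊤ := by
  apply hK.measure_lt_top_of_nhdsWithin
  intro x hx
  obtain ⟨U, hU, hxU, hlt⟩ := μ.locFin p q x (hKΩ hx)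
  exact ⟨U, mem_nhdsWithin_of_mem_nhds (hU.mem_nhds hxU), hlt⟩

lemma aux_ae_mem {D N : ℕ} {Ω : Set (Fin D → ℝ)} (μ : MatRadonMeasure D N Ω)
    (p q : Fin N) : ∀ᵐ x ∂(μ.ρ p q), x ∈ Ω := by
  rw [ae_iff]
  exact μ.carried p q

lemma aux_restrict {D N : ℕ} {Ω : Set (Fin D → ℝ)} (μ : MatRadonMeasure D N Ω)
    (p q : Fin N) : (μ.ρ p q).restrict Ω = μ.ρ p q :=
  Measure.restrict_eq_self_of_ae_mem (aux_ae_mem μ p q)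

/-- Dominated convergence for `trInt`. -/
lemma aux_dct {D N : ℕ} {Ω : Set (Fin D → ℝ)} (hΩ : IsOpen Ω) (μ : MatRadonMeasure D N Ω)
    {K : Set (Fin D → ℝ)} (hK : IsCompact K) (hKΩ : K ⊆ Ω)
    (ψ : ℕ → (Fin D → ℝ) → Fin N → Fin N → ℂ) (ψ' : (Fin D → ℝ) → Fin N → Fin N → ℂ)
    (B : (Fin D → ℝ) → Fin N → Fin N → ℝ)
    (hB : ∀ p q, ContinuousOn (fun x => B x p q) K)
    (hcont : ∀ n p q, ContinuousOn (fun x => ψ n x p q) Ω)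
    (hbd : ∀ n p q, ∀ x ∈ K, ‖ψ n x p q‖ ≤ B x p q)
    (hout : ∀ n p q x, x ∉ K → ψ n x p q = 0)
    (hout' : ∀ p q x, x ∉ K → ψ' x p q = 0)
    (hlim : ∀ p q, ∀ x ∈ K, Tendsto (fun n => ψ n x p q) atTop (𝓝 (ψ' x p q))) :
    Tendsto (fun n => μ.trInt (ψ n)) atTop (𝓝 (μ.trInt ψ')) := by
  unfold MatRadonMeasure.trInt
  refine tendsto_finsetSum _ fun p _ => tendsto_finsetSum _ fun q _ => ?_
  obtain ⟨C, hC⟩ := hK.exists_bound_of_continuousOn (hB q p)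
  refine tendsto_integral_of_dominated_convergence (K.indicator fun _ => C) ?_ ?_ ?_ ?_
  · intro n
    refine AEStronglyMeasurable.mul ?_ (μ.meas_dens p q).aestronglyMeasurable
    have := (hcont n q p).aestronglyMeasurable (μ := μ.ρ p q) hΩ.measurableSet
    rwa [aux_restrict] at this
  · rw [integrable_indicator_iff hK.measurableSet]
    exact integrableOn_const (aux_compact_lt_top μ p q hK hKΩ).ne
  · intro n
    refine Eventually.of_forall fun x => ?_
    rw [norm_mul, μ.norm_dens, mul_one]
    by_cases hx : x ∈ K
    · rw [indicator_of_mem hx]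
      exact (hbd n q p x hx).trans ((le_abs_self _).trans (hC x hx))
    · rw [indicator_of_notMem hx, hout n q p x hx, norm_zero]
  · refine Eventually.of_forall fun x => ?_
    refine Tendsto.mul_const _ ?_
    by_cases hx : x ∈ K
    · exact hlim q p x hx
    · simp [hout _ q p x hx, hout' q p x hx]

lemma aux_zero {D N : ℕ} {Ω : Set (Fin D → ℝ)} (hΩ : IsOpen Ω) (μ : MatRadonMeasure D N Ω)
    {K : Set (Fin D → ℝ)} (hK : IsCompact K) (hKΩ : K ⊆ Ω)
    (h : ℕ → (Fin D → ℝ) → ℝ) (χ : (Fin D → ℝ) → ℝ) (hχ : Continuous χ)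
    (hh : ∀ n, Continuous (h n)) (hb : ∀ n x, |h n x| ≤ |χ x| * 2)
    (hout : ∀ n x, x ∉ K → h n x = 0)
    (hlim : ∀ x, Tendsto (fun n => h n x) atTop (𝓝 0))
    (k : (Fin D → ℝ) → Fin N → Fin N → ℂ) (hk : ∀ p q, ContinuousOn (fun x => k x p q) Ω) :
    Tendsto (fun n => μ.trInt (fun x q p => (h n x : ℂ) * k x q p)) atTop (𝓝 0) := by
  have h0 : μ.trInt (fun _ _ _ => 0) = 0 := by simp [MatRadonMeasure.trInt]
  rw [← h0]
  refine aux_dct hΩ μ hK hKΩ _ _ (fun x p q => |χ x| * 2 * ‖k x p q‖) ?_ ?_ ?_ ?_ ?_ ?_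
  · intro p q
    exact ((hχ.abs.mul continuous_const).continuousOn).mul ((hk p q).mono hKΩ).norm
  · intro n p q
    exact (Complex.continuous_ofReal.comp (hh n)).continuousOn.mul (hk p q)
  · intro n p q x _
    rw [norm_mul, Complex.norm_real]
    exact mul_le_mul_of_nonneg_right (hb n x) (norm_nonneg _)
  · intro n p q x hx
    simp [hout n x hx]
  · intros; rfl
  · intro p q x _
    have := (Complex.continuous_ofReal.tendsto 0).comp (hlim x)
    simpa using this.mul_const (k x p q)

lemma aux_iter {D : ℕ} {a : (Fin D → ℝ) → (Fin D → ℝ)} {U : Set (Fin D → ℝ)} (hU : IsOpen U)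
    (ha : ContDiffOn ℝ (⊤ : ℕ∞) a U) {γ : (Fin D → ℝ) → ℝ} (hγ : ContDiffOn ℝ (⊤ : ℕ∞) γ U)
    (k : ℕ) : ContDiffOn ℝ (⊤ : ℕ∞) (vfIter a k γ) U := by
  induction k with
  | zero => exact hγ
  | succ k ih => exact (ih.fderiv_of_isOpen hU (by simp)).clm_apply ha

lemma aux_contDiff {D : ℕ} {V : Set (Fin D → ℝ)} (hV : IsOpen V) {χ f : (Fin D → ℝ) → ℝ}
    (hχ : ContDiff ℝ (⊤ : ℕ∞) χ) (hs : tsupport χ ⊆ V) (hf : ContDiffOn ℝ (⊤ : ℕ∞) f V) :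
    ContDiff ℝ (⊤ : ℕ∞) (fun x => χ x * f x) := by
  rw [contDiff_iff_contDiffAt]
  intro x
  by_cases hx : x ∈ tsupport χ
  · exact hχ.contDiffAt.mul (hf.contDiffAt (hV.mem_nhds (hs hx)))
  · have : (fun x => χ x * f x) =ᶠ[𝓝 x] fun _ => 0 := by
      filter_upwards [(notMem_tsupport_iff_eventuallyEq.mp hx)] with y hy
      simp [hy]
    exact contDiffAt_const.congr_of_eventuallyEq this

/-- The tested form of `1_{γ = 0} (Hγ) μ = 0`. -/
lemma aux_test {D N : ℕ} {Ω : Set (Fin D → ℝ)} (hΩ : IsOpen Ω)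
    (a : (Fin D → ℝ) → (Fin D → ℝ)) (ha : ContDiffOn ℝ (⊤ : ℕ∞) a Ω)
    (b c : (Fin D → ℝ) → Fin N → Fin N → ℂ)
    (hb : ContDiffOn ℝ (⊤ : ℕ∞) b Ω) (hc : ContDiffOn ℝ (⊤ : ℕ∞) c Ω)
    (μ ν : MatRadonMeasure D N Ω) (heq : DistribEq a b c μ ν)
    {V : Set (Fin D → ℝ)} (hV : IsOpen V) (hVΩ : V ⊆ Ω) (γ : (Fin D → ℝ) → ℝ)
    (hγ : ContDiffOn ℝ (⊤ : ℕ∞) γ V) (χ : (Fin D → ℝ) → ℝ) (hχ : ContDiff ℝ (⊤ : ℕ∞) χ)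
    (hχc : HasCompactSupport χ) (hχs : tsupport χ ⊆ V) (E : Fin N → Fin N → ℂ) :
    μ.trInt (fun x q p => ((if γ x = 0 then χ x * vfDeriv a γ x else 0 : ℝ) : ℂ) * E q p)
      = 0 := by
  classical
  set K := tsupport χ with hKdef
  have hK : IsCompact K := hχc
  have hKΩ : K ⊆ Ω := hχs.trans hVΩ
  have hχ0 : ∀ x, x ∉ K → χ x = 0 := fun x hx => image_eq_zero_of_notMem_tsupport hx
  let g : ℕ → (Fin D → ℝ) → ℝ := fun n x => Real.arctan (((n : ℝ) + 1) * γ x) / ((n : ℝ) + 1)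
  let h : ℕ → (Fin D → ℝ) → ℝ := fun n x => χ x * g n x
  have hpos : ∀ n : ℕ, (0 : ℝ) < (n : ℝ) + 1 := fun n => by positivity
  have hgs : ∀ n, ContDiffOn ℝ (⊤ : ℕ∞) (g n) V := fun n =>
    (Real.contDiff_arctan.comp_contDiffOn (contDiffOn_const.mul hγ)).div_const _
  have hhs : ∀ n, ContDiff ℝ (⊤ : ℕ∞) (h n) := fun n => aux_contDiff hV hχ hχs (hgs n)
  have hgb : ∀ n x, |g n x| ≤ 2 / ((n : ℝ) + 1) := by
    intro n x
    have h1 := Real.arctan_lt_pi_div_two (((n : ℝ) + 1) * γ x)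
    have h2 := Real.neg_pi_div_two_lt_arctan (((n : ℝ) + 1) * γ x)
    have h3 := Real.pi_le_four
    rw [show g n x = Real.arctan (((n : ℝ) + 1) * γ x) / ((n : ℝ) + 1) from rfl, abs_div,
      abs_of_pos (hpos n)]
    refine div_le_div_of_nonneg_right ?_ (hpos n).le
    rw [abs_le]; constructor <;> linarith
  have hgb2 : ∀ n x, |g n x| ≤ 2 := fun n x => (hgb n x).trans
    (div_le_self (by norm_num) (by have : (0:ℝ) ≤ n := n.cast_nonneg; linarith))
  have hglim : ∀ x, Tendsto (fun n => g n x) atTop (𝓝 0) := by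
    intro x
    refine squeeze_zero_norm (fun n => hgb n x) ?_
    have := (tendsto_one_div_add_atTop_nhds_zero_nat (𝕜 := ℝ)).const_mul 2
    simpa [div_eq_mul_inv] using this
  have hhb : ∀ n x, |h n x| ≤ |χ x| * 2 := fun n x => by
    rw [abs_mul]; exact mul_le_mul_of_nonneg_left (hgb2 n x) (abs_nonneg _)
  have hhout : ∀ n x, x ∉ K → h n x = 0 := fun n x hx => by simp [h, hχ0 x hx]
  have hhlim : ∀ x, Tendsto (fun n => h n x) atTop (𝓝 0) := fun x => by
    simpa using (hglim x).const_mul (χ x)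
  have hhts : ∀ n, tsupport (h n) ⊆ K := fun n => tsupport_mul_subset_left
  -- the derivative
  have hdout : ∀ n x, x ∉ K → fderiv ℝ (h n) x = 0 := fun n x hx =>
    image_eq_zero_of_notMem_tsupport fun hx' => hx (hhts n (tsupport_fderiv_subset ℝ hx'))
  have hder : ∀ n, ∀ x ∈ K, fderiv ℝ (h n) x (a x) = g n x * fderiv ℝ χ x (a x)
      + χ x * vfDeriv a γ x * (1 / (1 + (((n : ℝ) + 1) * γ x) ^ 2)) := by
    intro n x hx
    have hγd : HasFDerivAt γ (fderiv ℝ γ x) x :=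
      ((hγ.contDiffAt (hV.mem_nhds (hχs hx))).differentiableAt (by simp)).hasFDerivAt
    have hχd : HasFDerivAt χ (fderiv ℝ χ x) x :=
      (hχ.contDiffAt.differentiableAt (by simp)).hasFDerivAt
    have h1 := ((hγd.const_mul ((n : ℝ) + 1)).arctan).mul_const (((n : ℝ) + 1)⁻¹)
    have h2 := (hχd.mul h1).fderiv
    have h3 : h n = χ * fun x => Real.arctan (((n : ℝ) + 1) * γ x) * ((n : ℝ) + 1)⁻¹ := by
      funext y; simp [h, g, div_eq_mul_inv]
    rw [h3, h2]
    have := (hpos n).ne'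
    simp [vfDeriv, g]
    field_simp
    ring
  let φ : ℕ → (Fin D → ℝ) → Fin N → Fin N → ℂ := fun n x q p => (h n x : ℂ) * E q p
  have hφs : ∀ n, ContDiff ℝ (⊤ : ℕ∞) (φ n) := by
    intro n
    rw [contDiff_pi]; intro q
    rw [contDiff_pi]; intro p
    exact (Complex.ofRealCLM.contDiff.comp (hhs n)).mul contDiff_const
  have hφt : ∀ n, tsupport (φ n) ⊆ K := by
    intro n
    refine closure_minimal (fun x hx => ?_) (isClosed_tsupport χ)
    by_contra hxK
    exact hx (by funext q p; simp [φ, hhout n x hxK])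
  have hφc : ∀ n, HasCompactSupport (φ n) := fun n =>
    HasCompactSupport.of_support_subset_isCompact hK ((subset_tsupport _).trans (hφt n))
  have key := fun n => heq (φ n) (hφs n) (hφc n) ((hφt n).trans hKΩ)
  have hbc : ∀ p q, ContinuousOn (fun x => b x p q) Ω := fun p q =>
    continuousOn_pi.1 (continuousOn_pi.1 hb.continuousOn p) q
  have hcc : ∀ p q, ContinuousOn (fun x => c x p q) Ω := fun p q =>
    continuousOn_pi.1 (continuousOn_pi.1 hc.continuousOn p) q
  have hdiv : ContinuousOn (divergence a) Ω := by
    unfold divergence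
    refine continuousOn_finsetSum _ fun l _ => ?_
    have := ((contDiffOn_pi.1 ha l).fderiv_of_isOpen hΩ (m := (⊤ : ℕ∞)) (by simp)).continuousOn
    exact this.clm_apply continuousOn_const
  have hνlim : Tendsto (fun n => ν.trInt (φ n)) atTop (𝓝 0) :=
    aux_zero hΩ ν hK hKΩ h χ hχ.continuous (fun n => (hhs n).continuous) hhb hhout hhlim
      (fun _ q p => E q p) (fun _ _ => continuousOn_const)
  have hblim : Tendsto (fun n => μ.trInt (fun x q p => ∑ r, φ n x q r * b x r p)) atTop (𝓝 0) := by
    have := aux_zero hΩ μ hK hKΩ h χ hχ.continuous (fun n => (hhs n).continuous) hhb hhout hhlim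
      (fun x q p => ∑ r, E q r * b x r p)
      (fun q p => continuousOn_finsetSum _ fun r _ => continuousOn_const.mul (hbc r p))
    simpa only [φ, Finset.mul_sum, mul_assoc] using this
  have hclim : Tendsto (fun n => μ.trInt (fun x q p => ∑ r, c x q r * φ n x r p)) atTop (𝓝 0) := by
    have := aux_zero hΩ μ hK hKΩ h χ hχ.continuous (fun n => (hhs n).continuous) hhb hhout hhlim
      (fun x q p => ∑ r, c x q r * E r p)
      (fun q p => continuousOn_finsetSum _ fun r _ => (hcc q r).mul continuousOn_const)
    simpa only [φ, Finset.mul_sum, mul_left_comm] using this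
  have hfd : ∀ n x q p, fderiv ℝ (fun y => φ n y q p) x (a x)
      = (fderiv ℝ (h n) x (a x) : ℂ) * E q p := by
    intro n x q p
    have h1 : HasFDerivAt (h n) (fderiv ℝ (h n) x) x :=
      ((hhs n).contDiffAt.differentiableAt (by simp)).hasFDerivAt
    have h2 := ((Complex.ofRealCLM.hasFDerivAt.comp x h1).mul_const (E q p)).fderiv
    have h3 : (fun y => φ n y q p) = fun y => (Complex.ofRealCLM ∘ h n) y * E q p := by
      funext y; simp [φ]
    rw [h3, h2]
    simp [mul_comm]
  have halim : Tendsto (fun n => μ.trInt (fun x q p => fderiv ℝ (fun y => φ n y q p) x (a x)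
          + (divergence a x : ℂ) * φ n x q p)) atTop
      (𝓝 (μ.trInt (fun x q p =>
        ((if γ x = 0 then χ x * vfDeriv a γ x else 0 : ℝ) : ℂ) * E q p))) := by
    have hχd : ContinuousOn (fun x => fderiv ℝ χ x (a x)) Ω :=
      (hχ.continuous_fderiv (by simp)).continuousOn.clm_apply ha.continuousOn
    have hγd : ContinuousOn (vfDeriv a γ) V :=
      (aux_iter hV (ha.mono hVΩ) hγ 1).continuousOn
    refine aux_dct hΩ μ hK hKΩ _ _
      (fun x q p => (2 * |fderiv ℝ χ x (a x)| + |χ x * vfDeriv a γ x|) * ‖E q p‖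
        + |divergence a x| * (|χ x| * 2 * ‖E q p‖)) ?_ ?_ ?_ ?_ ?_ ?_
    · intro q p
      have e1 := hχd.mono hKΩ
      have e2 := hγd.mono hχs
      have e3 := hdiv.mono hKΩ
      have e4 := hχ.continuous.continuousOn (s := K)
      fun_prop
    · intro n q p
      simp only [hfd]
      have e1 : ContinuousOn (fun x => fderiv ℝ (h n) x (a x)) Ω :=
        ((hhs n).continuous_fderiv (by simp)).continuousOn.clm_apply ha.continuousOn
      have e2 := (hhs n).continuous
      simp only [φ]
      refine ((Complex.continuous_ofReal.comp_continuousOn e1).mul continuousOn_const).add ?_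
      exact (Complex.continuous_ofReal.comp_continuousOn hdiv).mul
        ((Complex.continuous_ofReal.comp e2).continuousOn.mul continuousOn_const)
    · intro n q p x hx
      rw [hfd]
      refine (norm_add_le _ _).trans (add_le_add ?_ ?_)
      · rw [norm_mul, Complex.norm_real, hder n x hx]
        refine mul_le_mul_of_nonneg_right ?_ (norm_nonneg _)
        refine (norm_add_le _ _).trans (add_le_add ?_ ?_)
        · rw [norm_mul]
          exact mul_le_mul_of_nonneg_right (hgb2 n x) (norm_nonneg _)
        · rw [norm_mul]
          refine mul_le_of_le_one_right (norm_nonneg _) ?_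
          rw [Real.norm_eq_abs, abs_of_nonneg (by positivity), div_le_one (by positivity)]
          nlinarith [sq_nonneg (((n : ℝ) + 1) * γ x)]
      · simp only [φ]
        rw [norm_mul, norm_mul, Complex.norm_real, Complex.norm_real]
        refine mul_le_mul_of_nonneg_left ?_ (norm_nonneg _)
        exact mul_le_mul_of_nonneg_right (hhb n x) (norm_nonneg _)
    · intro n q p x hx
      rw [hfd]
      simp [φ, hhout n x hx, hdout n x hx]
    · intro q p x hx
      simp [hχ0 x hx]
    · intro q p x hx
      simp only [hfd]
      have e1 : Tendsto (fun n => fderiv ℝ (h n) x (a x)) atTop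
          (𝓝 (if γ x = 0 then χ x * vfDeriv a γ x else 0)) := by
        simp only [hder _ x hx]
        have l1 := (hglim x).mul_const (fderiv ℝ χ x (a x))
        rw [zero_mul] at l1
        split_ifs with h0
        · have := l1.add_const (χ x * vfDeriv a γ x)
          simpa [h0] using this
        · have l2 : Tendsto (fun n : ℕ => 1 / (1 + (((n : ℝ) + 1) * γ x) ^ 2)) atTop (𝓝 0) := by
            refine squeeze_zero (fun n => by positivity) (g := fun n : ℕ =>
              (1 / ((n : ℝ) + 1)) * (1 / γ x ^ 2)) ?_ ?_
            · intro n
              have hg2 : 0 < γ x ^ 2 := by positivity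
              rw [div_mul_div_comm, mul_one]
              refine one_div_le_one_div_of_le (by positivity) ?_
              have : (0:ℝ) ≤ n := n.cast_nonneg
              have h5 : ((n : ℝ) + 1) ≤ ((n : ℝ) + 1) ^ 2 := by nlinarith
              rw [mul_pow]
              nlinarith [mul_le_mul_of_nonneg_right h5 hg2.le]
            · have l3 := (tendsto_one_div_add_atTop_nhds_zero_nat (𝕜 := ℝ)).mul_const
                (1 / γ x ^ 2)
              rwa [zero_mul] at l3
          simpa using l1.add (l2.const_mul (χ x * vfDeriv a γ x))
      have e2 := ((Complex.continuous_ofReal.tendsto _).comp e1).mul_const (E q p)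
      have e3 := (((Complex.continuous_ofReal.tendsto _).comp (hhlim x)).mul_const
        (E q p)).const_mul (divergence a x : ℂ)
      have e4 := e2.add e3
      simp only [Complex.ofReal_zero, zero_mul, mul_zero, add_zero] at e4
      exact e4
  have hall := ((halim.neg.add hblim).add hclim)
  simp only [add_zero] at hall
  have := tendsto_nhds_unique (hall.congr key) hνlim
  exact neg_eq_zero.1 this

/-- `|μ_{pq}|` does not charge the points of `{γ = 0}` at which `Hγ ≠ 0`. -/
lemma aux_null {D N : ℕ} {Ω : Set (Fin D → ℝ)} (hΩ : IsOpen Ω)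
    (a : (Fin D → ℝ) → (Fin D → ℝ)) (ha : ContDiffOn ℝ (⊤ : ℕ∞) a Ω)
    (b c : (Fin D → ℝ) → Fin N → Fin N → ℂ)
    (hb : ContDiffOn ℝ (⊤ : ℕ∞) b Ω) (hc : ContDiffOn ℝ (⊤ : ℕ∞) c Ω)
    (μ ν : MatRadonMeasure D N Ω) (heq : DistribEq a b c μ ν)
    {V : Set (Fin D → ℝ)} (hV : IsOpen V) (hVΩ : V ⊆ Ω) (γ : (Fin D → ℝ) → ℝ)
    (hγ : ContDiffOn ℝ (⊤ : ℕ∞) γ V) (p q : Fin N) :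
    μ.ρ p q {x | x ∈ V ∧ γ x = 0 ∧ vfDeriv a γ x ≠ 0} = 0 := by
  classical
  let f : (Fin D → ℝ) → ℂ := fun x =>
    ((if γ x = 0 then vfDeriv a γ x else 0 : ℝ) : ℂ) * μ.dens p q x
  have hγd : ContinuousOn (vfDeriv a γ) V := (aux_iter hV (ha.mono hVΩ) hγ 1).continuousOn
  have hop : IsOpen (V ∩ γ ⁻¹' {0}ᶜ) :=
    hγ.continuousOn.isOpen_inter_preimage hV isClosed_singleton.isOpen_compl
  have hfm : AEStronglyMeasurable f ((μ.ρ p q).restrict V) := by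
    refine AEStronglyMeasurable.mul ?_ (μ.meas_dens p q).aestronglyMeasurable
    refine Complex.continuous_ofReal.comp_aestronglyMeasurable ?_
    have h1 := (hγd.aestronglyMeasurable (μ := μ.ρ p q) hV.measurableSet).indicator
      hop.measurableSet.compl
    refine h1.congr ?_
    filter_upwards [ae_restrict_mem hV.measurableSet] with x hx
    by_cases h0 : γ x = 0 <;> simp [indicator, h0, hx]
  have hfi : LocallyIntegrableOn f V (μ.ρ p q) := by
    rw [locallyIntegrableOn_iff hV.isLocallyClosed]
    intro K hKV hK
    obtain ⟨C, hC⟩ := hK.exists_bound_of_continuousOn (hγd.mono hKV)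
    have hlt := aux_compact_lt_top μ p q hK (hKV.trans hVΩ)
    have : IsFiniteMeasure ((μ.ρ p q).restrict K) := ⟨by simpa using hlt⟩
    refine Integrable.of_bound (hfm.mono_measure (Measure.restrict_mono hKV le_rfl)) C ?_
    filter_upwards [ae_restrict_mem hK.measurableSet] with x hx
    have h2 := hC x hx
    simp only [f]
    rw [norm_mul, μ.norm_dens, mul_one, Complex.norm_real]
    split_ifs
    · exact h2
    · rw [norm_zero]; exact (norm_nonneg _).trans h2
  have hz : ∀ᵐ x ∂(μ.ρ p q), x ∈ V → f x = 0 := by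
    refine hV.ae_eq_zero_of_integral_contDiff_smul_eq_zero hfi ?_
    intro χ hχ hχc hχs
    have := aux_test hΩ a ha b c hb hc μ ν heq hV hVΩ γ hγ χ hχ hχc hχs
      (fun q' p' => if q' = q then (if p' = p then 1 else 0) else 0)
    unfold MatRadonMeasure.trInt at this
    rw [Finset.sum_eq_single p, Finset.sum_eq_single q] at this
    · rw [← this]
      refine integral_congr_ae (Eventually.of_forall fun x => ?_)
      by_cases h0 : γ x = 0 <;> simp [f, h0, mul_assoc]
    · intro q' _ hq'; simp [hq']
    · simp
    · intro p' _ hp'; simp [hp']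
    · simp
  refine measure_mono_null ?_ (ae_iff.1 hz)
  rintro x ⟨hxV, h0, h1⟩
  have hd : μ.dens p q x ≠ 0 := by
    rw [← norm_pos_iff, μ.norm_dens]; exact one_pos
  simp [f, hxV, h0, h1, hd]

/-- The part of `Ω` off the support is null for the total variations. -/
lemma aux_support {D N : ℕ} {Ω : Set (Fin D → ℝ)} (ν : MatRadonMeasure D N Ω) (p q : Fin N) :
    ν.ρ p q (Ω \ ν.support) = 0 := by
  refine measure_null_of_locally_null _ ?_
  rintro x ⟨hxΩ, hxs⟩
  have : ∃ V, IsOpen V ∧ x ∈ V ∧ ν.VanishesOn V := by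
    by_contra hcon
    push Not at hcon
    exact hxs ⟨hxΩ, hcon⟩
  obtain ⟨V, hV, hxV, hvan⟩ := this
  obtain ⟨U, hU, hxU, hlt⟩ := ν.locFin p q x hxΩ
  refine ⟨V ∩ U, mem_nhdsWithin_of_mem_nhds ((hV.inter hU).mem_nhds ⟨hxV, hxU⟩), ?_⟩
  set W := V ∩ U
  have hW : MeasurableSet W := (hV.inter hU).measurableSet
  have hWlt : ν.ρ p q W < ⊤ := (measure_mono inter_subset_right).trans_lt hlt
  have : IsFiniteMeasure ((ν.ρ p q).restrict W) := ⟨by simpa using hWlt⟩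
  have hint : Integrable (ν.dens p q) ((ν.ρ p q).restrict W) :=
    Integrable.of_bound (ν.meas_dens p q).aestronglyMeasurable 1
      (Eventually.of_forall fun x => (ν.norm_dens p q x).le)
  have h0 : ν.dens p q =ᵐ[(ν.ρ p q).restrict W] 0 := by
    refine ae_eq_zero_of_forall_setIntegral_eq_of_sigmaFinite
      (fun s _ _ => hint.integrableOn) fun s hs _ => ?_
    rw [Measure.restrict_restrict hs]
    exact hvan p q (s ∩ W) (inter_subset_right.trans inter_subset_left) (hs.inter hW)
  have h1 : (ν.ρ p q).restrict W = 0 := by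
    rw [← ae_eq_bot, ← eventually_false_iff_eq_bot]
    filter_upwards [h0] with x hx
    have := ν.norm_dens p q x
    rw [hx] at this
    simp at this
  exact Measure.restrict_eq_zero.1 h1

lemma aux_key {D N : ℕ} {Ω : Set (Fin D → ℝ)} (hΩ : IsOpen Ω)
    (a : (Fin D → ℝ) → (Fin D → ℝ)) (ha : ContDiffOn ℝ (⊤ : ℕ∞) a Ω)
    (b c : (Fin D → ℝ) → Fin N → Fin N → ℂ)
    (hb : ContDiffOn ℝ (⊤ : ℕ∞) b Ω) (hc : ContDiffOn ℝ (⊤ : ℕ∞) c Ω)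
    (μ ν : MatRadonMeasure D N Ω) (heq : DistribEq a b c μ ν) (hac : ν.AC μ)
    {U : Set (Fin D → ℝ)} (hU : IsOpen U) (hUΩ : U ⊆ Ω) (γ : (Fin D → ℝ) → ℝ)
    (hγ : ContDiffOn ℝ (⊤ : ℕ∞) γ U) (hs : ∀ y ∈ ν.support, y ∈ U → γ y = 0)
    (x : Fin D → ℝ) (hx : x ∈ U) (k : ℕ) (hk : vfIter a k γ x ≠ 0) : x ∉ ν.support := by
  rintro ⟨-, hxs⟩
  set V := U ∩ vfIter a k γ ⁻¹' {0}ᶜ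
  have hV : IsOpen V := (aux_iter hU (ha.mono hUΩ) hγ k).continuousOn.isOpen_inter_preimage hU
    isClosed_singleton.isOpen_compl
  have hop : IsOpen (U ∩ γ ⁻¹' {0}ᶜ) :=
    hγ.continuousOn.isOpen_inter_preimage hU isClosed_singleton.isOpen_compl
  have hnull : ∀ p q, μ.ρ p q (V \ (U ∩ γ ⁻¹' {0}ᶜ)) = 0 := by
    intro p q
    refine measure_mono_null (t := ⋃ i : ℕ, {y | y ∈ U ∧ vfIter a i γ y = 0 ∧
      vfDeriv a (vfIter a i γ) y ≠ 0}) ?_ (measure_iUnion_null fun i =>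
        aux_null hΩ a ha b c hb hc μ ν heq hU hUΩ _ (aux_iter hU (ha.mono hUΩ) hγ i) p q)
    rintro y ⟨⟨hyU, hyk⟩, hy0⟩
    have h0 : vfIter a 0 γ y = 0 := by
      by_contra hne
      exact hy0 ⟨hyU, hne⟩
    by_contra hcon
    simp only [mem_iUnion, mem_ofPred_eq, not_exists, not_and, not_not] at hcon
    have hall : ∀ i, vfIter a i γ y = 0 := by
      intro i
      induction i with
      | zero => exact h0
      | succ i ih => exact hcon i hyU ih
    exact hyk (hall k)
  have hν := hac _ (hV.measurableSet.diff hop.measurableSet) hnull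
  have hνV : ∀ p q, ν.ρ p q V = 0 := by
    intro p q
    refine measure_mono_null ?_ (measure_union_null (hν p q) (aux_support ν p q))
    intro y hy
    by_cases h0 : γ y = 0
    · exact Or.inl ⟨hy, fun h => h.2 h0⟩
    · exact Or.inr ⟨hUΩ hy.1, fun h => h0 (hs y h hy.1)⟩
  refine hxs V hV ⟨hx, hk⟩ ?_
  intro p q B hB _
  unfold MatRadonMeasure.entry
  rw [Measure.restrict_eq_zero.2 (measure_mono_null hB (hνV p q)), integral_zero_measure]

end Aux

/-- Proposition 3.4 of the paper: under the hypotheses of Lemma 3.5,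
for every ordinal `α`, `supp ν ⊆ F(α;H;Σ)`. -/
theorem support_subset_Fset
    {D N : ℕ} (hD : 1 ≤ D) (Ω S : Set (Fin D → ℝ)) (hΩ : IsOpen Ω)
    (a : (Fin D → ℝ) → (Fin D → ℝ)) (ha : ContDiffOn ℝ (⊤ : ℕ∞) a Ω)
    (ha0 : ∀ x ∈ Ω, a x ≠ 0)
    (hS : IsHypersurface Ω S) (hScl : closure S ∩ Ω ⊆ S)
    (b c : (Fin D → ℝ) → Fin N → Fin N → ℂ)
    (hb : ContDiffOn ℝ (⊤ : ℕ∞) b Ω) (hc : ContDiffOn ℝ (⊤ : ℕ∞) c Ω)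
    (μ ν : MatRadonMeasure D N Ω)
    (heq : DistribEq a b c μ ν)
    (hac : ν.AC μ)
    (hsupp : ν.support ⊆ S) :
    ∀ α : Ordinal, ν.support ⊆ Fset a Ω S α := by
  intro α
  induction α using Ordinal.limitRecOn with
  | zero =>
    intro x hx
    rw [Fset, Ordinal.limitRecOn_zero]
    have hxS := hsupp hx
    obtain ⟨U, γ, hdef, hxU⟩ := hS.2 x hxS
    refine ⟨hxS, U, γ, hdef, hxU, fun i _ => ?_⟩
    by_contra hne
    obtain ⟨hU, hUΩ, hγ, -, heqS⟩ := hdef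
    refine aux_key hΩ a ha b c hb hc μ ν heq hac hU hUΩ γ hγ ?_ x hxU i hne hx
    intro y hy hyU
    have : y ∈ S ∩ U := ⟨hsupp hy, hyU⟩
    rw [heqS] at this
    exact this.2
  | add_one β ih =>
    intro x hx
    rw [Fset, Ordinal.limitRecOn_add_one]
    refine ⟨ih hx, ?_⟩
    rintro ⟨U, Θ, hU, hxU, hUΩ, hΘ, hsub, k, hxΘ, W, γ, ⟨hW, hWU, hγ, -, heqΘ⟩, hxW, -, hne⟩
    refine aux_key hΩ a ha b c hb hc μ ν heq hac hW (hWU.trans hUΩ) γ hγ ?_ x hxW (k + 1) hne hx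
    intro y hy hyW
    have : y ∈ Θ ∩ W := ⟨hsub ⟨ih hy, hWU hyW⟩, hyW⟩
    rw [heqΘ] at this
    exact this.2
  | limit β hβ ih =>
    intro x hx
    rw [Fset, Ordinal.limitRecOn_limit _ _ _ _ hβ]
    exact Set.mem_iInter₂.2 fun o ho => ih o ho hx
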